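/- The 8×8 nonnegative matrix C = [[0,8,0,0,0,0,0,0], [0,0,10,0,0,0,0,0], [57/140,13/5,0,7,0,5,0,0], [67/140,1/14,0,0,4,0,5,0], [19/140,1/70,0,0,0,0,0,5], [11/20,23/70,0,7,0,0,0,0], [67/140,1/14,0,5,4,0,0,0], [19/140,1/70,0,0,5,0,0,0]] has characteristic polynomial (X − 8)(X − 2)³(X − 1)(X + 5)³, i.e., its spectrum counted with multiplicity is {8, 2, 2, 2, 1, −5, −5, −5}. -/

import Mathlib

open Polynomial Matrix

theorem charpoly_eq_of_mul_eq_mul {n R : Type*} [Fintype n] [DecidableEq n] [CommRing R]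
    {M T P Q : Matrix n n R} (hPQ : P * Q = 1) (h : M * Q = Q * T) :
    M.charpoly = T.charpoly := by
  have hM : M = Q * T * P := by rw [← h, mul_assoc, mul_eq_one_comm.mp hPQ, mul_one]
  rw [hM, Matrix.charpoly_mul_comm, ← mul_assoc, hPQ, one_mul]

/-- Columns form a basis of generalized eigenvectors of the displayed matrix. -/
noncomputable def eigenbasis : Matrix (Fin 8) (Fin 8) ℝ :=
  !![140, -280, -1260, 1260, -2240, 70000, -98000, 19600;
     140, -70, 140, -560, -280, -43750, 61250, -12250;
     112, -14, 119, -161, -28, 21875, -30625, 6125;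
     35, 29, 72, 0, 196, -4655, 4825, -965;
     7, 13, 0, 0, 77, -1775, 2485, -920;
     46, 13, 13, 155, 48, 1692, 0, 0;
     35, 29, 72, 0, 196, 0, 1692, 0;
     7, 13, 0, 0, 77, 0, 0, 423]

/-- The inverse of `eigenbasis`. -/
noncomputable def eigenbasisInv : Matrix (Fin 8) (Fin 8) ℝ :=
  !![4097 / 4815720, 16 / 9555, 4 / 1911, 4 / 819, 16 / 2457, 5 / 3822, 5 / 1638, 10 / 2457;
     -8519603 / 235970280, 463 / 72030, 7577 / 93639, -5806 / 40131, 21236 / 120393, 75055 / 187278, -56645 / 80262, 89210 / 120393;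
     -151751 / 67420080, -1 / 10290, 113 / 26754, -29 / 11466, -110 / 17199, 1195 / 53508, -775 / 22932, 355 / 17199;
     817 / 740880, -1 / 1470, -1 / 294, 1 / 126, -2 / 189, -5 / 588, 5 / 252, -5 / 189;
     31 / 5145, -1 / 735, -2 / 147, 1 / 42, -1 / 42, -10 / 147, 5 / 42, -5 / 42;
     -713 / 1848433860, 713 / 105624792, -713 / 52812396, -1525 / 3772314, 305 / 1886157, 713 / 52812396, 1525 / 3772314, -305 / 1886157;
     -1073 / 1109060316, 5365 / 316874376, -5365 / 158437188, -1538 / 5658471, -1445 / 11316942, 5365 / 158437188, 1538 / 5658471, 1445 / 11316942;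
     -355 / 277265079, 1775 / 79218594, -1775 / 39609297, 355 / 11316942, -13519 / 11316942, 1775 / 39609297, -355 / 11316942, 13519 / 11316942]

/-- The displayed matrix written in the basis `eigenbasis`. -/
noncomputable def triangularForm : Matrix (Fin 8) (Fin 8) ℝ :=
  !![8, 0, 0, 0, 0, 0, 0, 0;
     0, 2, -13, 163 / 13, 0, 0, 0, 0;
     0, 0, 2, 36 / 13, 0, 0, 0, 0;
     0, 0, 0, 2, 0, 0, 0, 0;
     0, 0, 0, 0, 1, 0, 0, 0;
     0, 0, 0, 0, 0, -5, 0, 0;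
     0, 0, 0, 0, 0, 0, -5, 0;
     0, 0, 0, 0, 0, 0, 0, -5]

theorem eigenbasisInv_mul_eigenbasis : eigenbasisInv * eigenbasis = 1 := by
  ext i j
  fin_cases i <;> fin_cases j <;>
    simp [eigenbasisInv, eigenbasis, Matrix.mul_apply, Fin.sum_univ_eight] <;> norm_num

theorem isUpperTriangular_triangularForm : triangularForm.IsUpperTriangular := by
  intro i j hij
  fin_cases i <;> fin_cases j <;> first | rfl | exact absurd hij (by decide)

theorem charpoly_triangularForm :
    triangularForm.charpoly = (X - C 8) * (X - C 2) ^ 3 * (X - C 1) * (X + C 5) ^ 3 := by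
  rw [Matrix.charpoly_of_isUpperTriangular _ isUpperTriangular_triangularForm,
    Fin.prod_univ_eight]
  simp [triangularForm]
  ring

/-- The displayed `8 × 8` nonnegative matrix has spectrum
`{8, 2, 2, 2, 1, -5, -5, -5}`. -/
theorem stmt_16 (M : Matrix (Fin 8) (Fin 8) ℝ)
    (hM : M = !![0, 8, 0, 0, 0, 0, 0, 0;
                 0, 0, 10, 0, 0, 0, 0, 0;
                 57 / 140, 13 / 5, 0, 7, 0, 5, 0, 0;
                 67 / 140, 1 / 14, 0, 0, 4, 0, 5, 0;
                 19 / 140, 1 / 70, 0, 0, 0, 0, 0, 5;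
                 11 / 20, 23 / 70, 0, 7, 0, 0, 0, 0;
                 67 / 140, 1 / 14, 0, 5, 4, 0, 0, 0;
                 19 / 140, 1 / 70, 0, 0, 5, 0, 0, 0]) :
    (∀ i j, 0 ≤ M i j) ∧
      M.charpoly = (X - C 8) * (X - C 2) ^ 3 * (X - C 1) * (X + C 5) ^ 3 := by
  subst hM
  constructor
  · intro i j
    fin_cases i <;> fin_cases j <;> norm_num
  · rw [← charpoly_triangularForm]
    refine charpoly_eq_of_mul_eq_mul eigenbasisInv_mul_eigenbasis ?_
    ext i j
    fin_cases i <;> fin_cases j <;>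
      simp [triangularForm, eigenbasis, Matrix.mul_apply, Fin.sum_univ_eight] <;> norm_num
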